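/- arXiv:1906.10624 — 2 statements merged into one kernel-verified Lean document; each statement's English description precedes it below -/
import Mathlib

section
/- Let ν ∈ (0,1). The function g(ω) = (1/(2+ν)) ω^{1−ν} + ((1+ν)/(2+ν)) (1−ω)^{1−ν} on [0,1] attains its maximum uniquely at ω₁* = 1/(1 + (1+ν)^{1/ν}); consequently the optimal weight on the second (better) investment is ω₂* = 1 − ω₁* = 1/(1 + (1+ν)^{−1/ν}). -/
theorem rpow_tangent_aux (p x a : ℝ) (hp : 0 < p) (hp1 : p < 1) (hx : 0 ≤ x) (ha : 0 < a)
    (hne : x ≠ a) : x ^ p < a ^ p + p * (a ^ p / a) * (x - a) := by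
  have h1 : (-1 : ℝ) ≤ x / a - 1 := by
    have : 0 ≤ x / a := by positivity
    linarith
  have h2 : x / a - 1 ≠ 0 := by
    intro h
    apply hne
    have h3 : x / a = 1 := by linarith
    rwa [div_eq_one_iff_eq ha.ne'] at h3
  have h := rpow_one_add_lt_one_add_mul_self h1 h2 hp hp1
  have h4 : 1 + (x / a - 1) = x / a := by ring
  rw [h4, Real.div_rpow hx ha.le] at h
  have hap : 0 < a ^ p := Real.rpow_pos_of_pos ha p
  rw [div_lt_iff₀ hap] at h
  have h5 : (1 + p * (x / a - 1)) * a ^ p = a ^ p + p * (a ^ p / a) * (x - a) := by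
    field_simp
  linarith

/-- For `ν ∈ (0,1)`, the function
`g(ω) = (1/(2+ν)) ω^{1−ν} + ((1+ν)/(2+ν)) (1−ω)^{1−ν}` on `[0,1]` attains its
maximum uniquely at `ω₁* = 1/(1 + (1+ν)^{1/ν})`, and the optimal weight on the
second investment is `ω₂* = 1 − ω₁* = 1/(1 + (1+ν)^{−1/ν})`. -/
theorem swp_two_assets_optimum (ν : ℝ) (hν : ν ∈ Set.Ioo (0 : ℝ) 1) :
    let g : ℝ → ℝ := fun ω =>
      (1 / (2 + ν)) * ω ^ (1 - ν) + ((1 + ν) / (2 + ν)) * (1 - ω) ^ (1 - ν)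
    let ω₁ : ℝ := 1 / (1 + (1 + ν) ^ (1 / ν))
    ω₁ ∈ Set.Icc (0 : ℝ) 1 ∧
      (∀ ω ∈ Set.Icc (0 : ℝ) 1, g ω ≤ g ω₁) ∧
      (∀ ω ∈ Set.Icc (0 : ℝ) 1, ω ≠ ω₁ → g ω < g ω₁) ∧
      1 - ω₁ = 1 / (1 + (1 + ν) ^ (-(1 / ν))) := by
  obtain ⟨h0, h1⟩ := hν
  intro g ω₁
  have hK : 0 < (1 + ν) ^ (1 / ν) := Real.rpow_pos_of_pos (by linarith) _
  have hKp : (1 + ν) * ((1 + ν) ^ (1 / ν)) ^ (1 - ν) = (1 + ν) ^ (1 / ν) := by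
    have e : 1 + 1 / ν * (1 - ν) = 1 / ν := by field_simp; ring
    rw [← Real.rpow_mul (by linarith)]
    nth_rewrite 1 [← Real.rpow_one (1 + ν)]
    rw [← Real.rpow_add (by linarith), e]
  have hneg : (1 + ν) ^ (-(1 / ν)) = ((1 + ν) ^ (1 / ν))⁻¹ := Real.rpow_neg (by linarith) _
  have hω : ω₁ = 1 / (1 + (1 + ν) ^ (1 / ν)) := rfl
  rw [hneg]
  clear_value ω₁
  generalize (1 + ν) ^ (1 / ν) = K at *
  have ha : 0 < ω₁ := by rw [hω]; positivity
  have hb : 1 - ω₁ = K * ω₁ := by rw [hω]; field_simp; ring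
  have hb0 : 0 < 1 - ω₁ := by rw [hb]; positivity
  have hfoc : (1 + ν) * ((1 - ω₁) ^ (1 - ν) / (1 - ω₁)) = ω₁ ^ (1 - ν) / ω₁ := by
    rw [hb, Real.mul_rpow hK.le ha.le, ← mul_div_assoc, ← mul_assoc, hKp]
    field_simp
  have main : ∀ ω ∈ Set.Icc (0 : ℝ) 1, ω ≠ ω₁ → g ω < g ω₁ := by
    intro ω hw hne
    have t1 := rpow_tangent_aux (1 - ν) ω ω₁ (by linarith) (by linarith) hw.1 ha hne
    have t2 := rpow_tangent_aux (1 - ν) (1 - ω) (1 - ω₁) (by linarith) (by linarith)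
      (by linarith [hw.2]) hb0 (fun h => hne (by linarith))
    have t3 := mul_lt_mul_of_pos_left t2 (show 0 < 1 + ν by linarith)
    have e : (1 + ν) * ((1 - ω₁) ^ (1 - ν) +
        (1 - ν) * ((1 - ω₁) ^ (1 - ν) / (1 - ω₁)) * (1 - ω - (1 - ω₁)))
        = (1 + ν) * (1 - ω₁) ^ (1 - ν) - (1 - ν) * (ω₁ ^ (1 - ν) / ω₁) * (ω - ω₁) := by
      rw [← hfoc]; ring
    rw [e] at t3
    have gg : ∀ y, g y = (y ^ (1 - ν) + (1 + ν) * (1 - y) ^ (1 - ν)) / (2 + ν) := by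
      intro y; simp only [g]; ring
    rw [gg, gg]
    apply div_lt_div_of_pos_right _ (by linarith)
    linarith
  refine ⟨⟨ha.le, by linarith⟩, ?_, main, ?_⟩
  · intro ω hw
    by_cases h : ω = ω₁
    · rw [h]
    · exact (main ω hw h).le
  · rw [hb, hω]; field_simp; try ring
end

section
/- Let n ≥ 2, 1 ≤ i < j ≤ n be integers and ν ∈ (0,1). With C(n,i,j) = Γ(n+1)/(Γ(i)Γ(j−i)Γ(n+1−j)), the mixed moment of the pair of order statistics satisfies C(n,i,j) · ∫_0^1 ∫_0^v u^{ν+i−1} v^ν (v−u)^{j−i−1} (1−v)^{n−j} du dv = (Γ(n+1)Γ(ν+1)Γ(ν+i)/(Γ(i)Γ(n+1−j))) · ∑_{k=0}^∞ (−1)^k Γ(n+k+1−j)/(Γ(k+1)Γ(ν+1−k)Γ(ν+n+k+1)), where the series on the right-hand side converges. -/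
open MeasureTheory intervalIntegral

lemma mm_beta (a b v : ℝ) (ha : 0 < a) (hb : 0 < b) (hv : 0 < v) :
    ∫ u in (0:ℝ)..v, u ^ (a - 1) * (v - u) ^ (b - 1) =
      v ^ (a + b - 1) * (Real.Gamma a * Real.Gamma b / Real.Gamma (a + b)) := by
  have h := Complex.betaIntegral_scaled (a : ℂ) (b : ℂ) hv
  rw [Complex.betaIntegral_eq_Gamma_mul_div _ _ (by simpa) (by simpa)] at h
  have h2 : ∫ x in (0:ℝ)..v, (x : ℂ) ^ ((a : ℂ) - 1) * ((v : ℂ) - x) ^ ((b : ℂ) - 1) =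
      ∫ x in (0:ℝ)..v, ((x ^ (a - 1) * (v - x) ^ (b - 1) : ℝ) : ℂ) := by
    apply intervalIntegral.integral_congr
    intro x hx
    rw [Set.uIcc_of_le hv.le] at hx
    have h1 : 0 ≤ v - x := by linarith [hx.2]
    simp only
    rw [Complex.ofReal_mul, Complex.ofReal_cpow hx.1, Complex.ofReal_cpow h1]
    push_cast
    rfl
  rw [h2, intervalIntegral.integral_ofReal] at h
  have h3 : (v : ℂ) ^ ((a : ℂ) + b - 1) = ((v ^ (a + b - 1) : ℝ) : ℂ) := by
    rw [Complex.ofReal_cpow hv.le]; push_cast; rfl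
  rw [h3, Complex.Gamma_ofReal, Complex.Gamma_ofReal, ← Complex.ofReal_add,
    Complex.Gamma_ofReal] at h
  exact_mod_cast h

lemma mm_choose_succ (ν : ℝ) (k : ℕ) :
    ((k : ℝ) + 1) * Ring.choose ν (k + 1) = (ν - k) * Ring.choose ν k := by
  rw [Ring.choose_eq_smul, Ring.choose_eq_smul, descPochhammer_succ_right,
    Polynomial.smeval_mul, Nat.factorial_succ]
  have : (Polynomial.X - (k : Polynomial ℤ)).smeval ν = ν - k := by
    rw [Polynomial.smeval_sub, Polynomial.smeval_X, Polynomial.smeval_natCast]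
    simp
  rw [this]
  have : (k.factorial : ℝ) ≠ 0 := by positivity
  have : (k : ℝ) + 1 ≠ 0 := by positivity
  push_cast
  simp only [smul_eq_mul]
  field_simp

lemma mm_choose_Gamma (ν : ℝ) (hν : ν ∈ Set.Ioo (0 : ℝ) 1) (k : ℕ) :
    Ring.choose ν k = Real.Gamma (ν + 1) / (Real.Gamma ((k : ℝ) + 1) * Real.Gamma (ν + 1 - k)) := by
  have hne : ∀ k : ℕ, ν - k ≠ 0 := by
    intro k hk
    have h1 : ν = k := by linarith
    rw [h1] at hν
    have h2 : 0 < k := by exact_mod_cast hν.1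
    have h3 : k < 1 := by exact_mod_cast hν.2
    omega
  have hG : ∀ k : ℕ, Real.Gamma (ν + 1 - k) ≠ 0 := by
    intro k hk
    rw [Real.Gamma_eq_zero_iff] at hk
    obtain ⟨m, hm⟩ := hk
    have h1 : ν + 1 + m = k := by linarith
    have h2 : (m + 1 : ℝ) < k := by linarith [hν.1]
    have h3 : (k : ℝ) < m + 2 := by linarith [hν.2]
    have h2' : m + 1 < k := by exact_mod_cast h2
    have h3' : k < m + 2 := by exact_mod_cast h3
    omega
  induction k with
  | zero =>
    have := hG 0
    simp at this
    simp [this]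
  | succ k ih =>
    have h := mm_choose_succ ν k
    rw [ih] at h
    have h1 : Real.Gamma (ν + 1 - k) = (ν - k) * Real.Gamma (ν + 1 - (k + 1 : ℕ)) := by
      have := Real.Gamma_add_one (hne k)
      rw [show ν + 1 - k = ν - k + 1 by ring, this]
      congr 2
      push_cast; ring
    have hk : (k : ℝ) + 1 ≠ 0 := by positivity
    have h2 := Real.Gamma_add_one hk
    have h3 := hne k
    have h4 := hG (k + 1)
    have h5 : Real.Gamma ((k : ℝ) + 1) ≠ 0 := (Real.Gamma_pos_of_pos (by positivity)).ne'
    have h6 : ((k + 1 : ℕ) : ℝ) + 1 = (k : ℝ) + 1 + 1 := by push_cast; ring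
    rw [h6, h2]
    rw [h1] at h
    have : Ring.choose ν (k + 1) = ((k : ℝ) + 1) * Ring.choose ν (k + 1) / ((k : ℝ) + 1) := by
      field_simp
    rw [this, h]
    field_simp

lemma mm_sign (ν : ℝ) (hν : ν ∈ Set.Ioo (0 : ℝ) 1) (k : ℕ) :
    (-1 : ℝ) ^ (k + 1) * Ring.choose ν (k + 1) ≤ 0 := by
  induction k with
  | zero => simp; exact hν.1.le
  | succ k ih =>
    have h := mm_choose_succ ν (k + 1)
    have h1 : ((k + 1 : ℕ) : ℝ) + 1 > 0 := by positivity
    have h2 : 0 ≤ ((k + 1 : ℕ) : ℝ) - ν := by push_cast; linarith [hν.2, (Nat.cast_nonneg k : (0:ℝ) ≤ k)]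
    have h3 : (((k + 1 : ℕ) : ℝ) + 1) * ((-1 : ℝ) ^ (k + 1 + 1) * Ring.choose ν (k + 1 + 1)) =
        (((k + 1 : ℕ) : ℝ) - ν) * ((-1 : ℝ) ^ (k + 1) * Ring.choose ν (k + 1)) := by
      rw [pow_succ (-1 : ℝ) (k + 1)]
      linear_combination (-(-1 : ℝ) ^ (k + 1)) * h
    have h4 := mul_nonpos_of_nonneg_of_nonpos h2 ih
    rw [← h3] at h4
    exact nonpos_of_mul_nonpos_right h4 h1

lemma mm_hasSum (ν y : ℝ) (hy : 0 ≤ y) (hy1 : y < 1) :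
    HasSum (fun k : ℕ => (-1 : ℝ) ^ k * Ring.choose ν k * y ^ k) ((1 - y) ^ ν) := by
  have h := (Real.one_add_rpow_hasFPowerSeriesOnBall_zero (a := ν)).hasSum (y := -y) (by
    simp only [Metric.mem_eball, edist_zero_right, enorm_neg]
    rw [Real.enorm_of_nonneg hy]
    simpa using hy1)
  simp only [binomialSeries_apply, zero_add, smul_eq_mul, List.ofFn_const, List.prod_replicate] at h
  rw [← sub_eq_add_neg] at h
  convert! h using 2
  rw [neg_pow]; ring

lemma mm_hasSum_abs (ν y : ℝ) (hν : ν ∈ Set.Ioo (0 : ℝ) 1) (hy : 0 ≤ y) (hy1 : y < 1) :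
    HasSum (fun k : ℕ => |(-1 : ℝ) ^ k * Ring.choose ν k| * y ^ k) (2 - (1 - y) ^ ν) := by
  have h := (hasSum_ite_eq (0 : ℕ) (2 : ℝ)).sub (mm_hasSum ν y hy hy1)
  convert! h using 2 with k
  cases k with
  | zero => simp; norm_num
  | succ k => rw [abs_of_nonpos (mm_sign ν hν k)]; simp

lemma mm_key (ν p : ℝ) (m : ℕ) (hν : ν ∈ Set.Ioo (0 : ℝ) 1) (hp : 1 ≤ p) :
    HasSum (fun k : ℕ => (-1 : ℝ) ^ k * Ring.choose ν k *
        (Real.Gamma p * Real.Gamma ((m : ℝ) + k + 1) / Real.Gamma (p + (m + k + 1))))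
      (Real.Gamma (ν + p) * Real.Gamma ((m : ℝ) + 1) / Real.Gamma (ν + p + (m + 1))) := by
  have h := intervalIntegral.hasSum_integral_of_dominated_convergence (μ := volume)
    (a := 0) (b := 1)
    (F := fun (k : ℕ) (v : ℝ) =>
      (-1 : ℝ) ^ k * Ring.choose ν k * (v ^ (p - 1) * (1 - v) ^ (m + k)))
    (f := fun v : ℝ => v ^ ν * (v ^ (p - 1) * (1 - v) ^ m))
    (fun k v => |(-1 : ℝ) ^ k * Ring.choose ν k| * (1 - v) ^ k * (v ^ (p - 1) * (1 - v) ^ m))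
    ?_ ?_ ?_ ?_ ?_
  · convert! h using 1
    · ext k
      rw [intervalIntegral.integral_const_mul]
      congr 1
      have := mm_beta p (m + k + 1) 1 (by linarith) (by positivity) one_pos
      rw [Real.one_rpow, one_mul] at this
      rw [← this]
      congr 1; ext v
      congr 1
      rw [← Real.rpow_natCast]; congr 1; push_cast; ring
    · have := mm_beta (ν + p) (m + 1) 1 (by linarith [hν.1]) (by positivity) one_pos
      rw [Real.one_rpow, one_mul] at this
      rw [← this]
      apply intervalIntegral.integral_congr_ae
      filter_upwards with v hv
      rw [Set.uIoc_of_le zero_le_one] at hv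
      rw [← mul_assoc, ← Real.rpow_add hv.1, ← Real.rpow_natCast]
      congr 2 <;> ring
  · intro k
    refine Continuous.aestronglyMeasurable ?_
    have : Continuous fun v : ℝ => v ^ (p - 1) := Real.continuous_rpow_const (by linarith)
    fun_prop
  · intro k
    filter_upwards with v hv
    rw [Set.uIoc_of_le zero_le_one] at hv
    have h1 : 0 ≤ v ^ (p - 1) := Real.rpow_nonneg hv.1.le _
    have h2 : 0 ≤ 1 - v := by linarith [hv.2]
    rw [norm_mul, Real.norm_eq_abs, Real.norm_eq_abs,
      abs_of_nonneg (mul_nonneg h1 (pow_nonneg h2 _)), pow_add]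
    apply le_of_eq; ring
  · filter_upwards with v hv
    rw [Set.uIoc_of_le zero_le_one] at hv
    exact (mm_hasSum_abs ν (1 - v) hν (by linarith [hv.2]) (by linarith [hv.1])).summable.mul_right _
  · have hc : IntervalIntegrable (fun v : ℝ => (2 - v ^ ν) * (v ^ (p - 1) * (1 - v) ^ m))
        volume 0 1 := by
      apply Continuous.intervalIntegrable
      have : Continuous fun v : ℝ => v ^ (p - 1) := Real.continuous_rpow_const (by linarith)
      have : Continuous fun v : ℝ => v ^ ν := Real.continuous_rpow_const hν.1.le
      fun_prop
    refine hc.congr ?_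
    intro v hv
    rw [Set.uIoc_of_le zero_le_one] at hv
    have := ((mm_hasSum_abs ν (1 - v) hν (by linarith [hv.2]) (by linarith [hv.1])).mul_right
      (v ^ (p - 1) * (1 - v) ^ m)).tsum_eq
    rw [sub_sub_cancel] at this
    exact this.symm
  · filter_upwards with v hv
    rw [Set.uIoc_of_le zero_le_one] at hv
    have := ((mm_hasSum ν (1 - v) (by linarith [hv.2]) (by linarith [hv.1])).mul_right
      (v ^ (p - 1) * (1 - v) ^ m))
    rw [sub_sub_cancel] at this
    convert! this using 2 with k
    rw [pow_add]; ring

/-- The mixed moment `E[x_{(i)}^ν x_{(j)}^ν]` of the i-th and j-th uniform order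
statistics: with `C(n,i,j) = Γ(n+1)/(Γ(i)Γ(j−i)Γ(n+1−j))`,
`C(n,i,j)·∫₀¹∫₀ᵛ u^{ν+i−1} v^ν (v−u)^{j−i−1} (1−v)^{n−j} du dv`
equals `(Γ(n+1)Γ(ν+1)Γ(ν+i)/(Γ(i)Γ(n+1−j))) · ∑_{k≥0} (−1)^k
Γ(n+k+1−j)/(Γ(k+1)Γ(ν+1−k)Γ(ν+n+k+1))`, the series being convergent. -/
theorem mixed_moment_order_statistics (n i j : ℕ) (hn : 2 ≤ n) (hi : 1 ≤ i)
    (hij : i < j) (hj : j ≤ n) (ν : ℝ) (hν : ν ∈ Set.Ioo (0 : ℝ) 1) :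
    Summable (fun k : ℕ => (-1 : ℝ) ^ k * Real.Gamma ((n : ℝ) + k + 1 - j) /
        (Real.Gamma ((k : ℝ) + 1) * Real.Gamma (ν + 1 - k) *
          Real.Gamma (ν + n + k + 1))) ∧
      (Real.Gamma ((n : ℝ) + 1) /
          (Real.Gamma (i : ℝ) * Real.Gamma ((j : ℝ) - i) * Real.Gamma ((n : ℝ) + 1 - j))) *
        ∫ v in (0:ℝ)..1, ∫ u in (0:ℝ)..v,
          u ^ (ν + (i : ℝ) - 1) * v ^ ν * (v - u) ^ ((j : ℝ) - i - 1) *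
            (1 - v) ^ ((n : ℝ) - j) =
      (Real.Gamma ((n : ℝ) + 1) * Real.Gamma (ν + 1) * Real.Gamma (ν + i) /
          (Real.Gamma (i : ℝ) * Real.Gamma ((n : ℝ) + 1 - j))) *
        ∑' k : ℕ, (-1 : ℝ) ^ k * Real.Gamma ((n : ℝ) + k + 1 - j) /
          (Real.Gamma ((k : ℝ) + 1) * Real.Gamma (ν + 1 - k) *
            Real.Gamma (ν + n + k + 1)) := by
  obtain ⟨m, rfl⟩ := Nat.exists_eq_add_of_le hj
  have hi' : (1 : ℝ) ≤ i := by exact_mod_cast hi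
  have hij' : (0 : ℝ) < (j : ℝ) - i := by
    have : (i : ℝ) < j := by exact_mod_cast hij
    linarith
  have hν0 := hν.1
  have hG1 : Real.Gamma (ν + 1) ≠ 0 := (Real.Gamma_pos_of_pos (by linarith)).ne'
  have hGj : Real.Gamma (ν + j) ≠ 0 := (Real.Gamma_pos_of_pos (by linarith)).ne'
  have hGi : Real.Gamma (i : ℝ) ≠ 0 := (Real.Gamma_pos_of_pos (by linarith)).ne'
  have hGji : Real.Gamma ((j : ℝ) - i) ≠ 0 := (Real.Gamma_pos_of_pos hij').ne'
  have hGm : Real.Gamma ((m : ℝ) + 1) ≠ 0 := (Real.Gamma_pos_of_pos (by positivity)).ne'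
  have hS : HasSum (fun k : ℕ => (-1 : ℝ) ^ k * Real.Gamma (((j + m : ℕ) : ℝ) + k + 1 - j) /
        (Real.Gamma ((k : ℝ) + 1) * Real.Gamma (ν + 1 - k) *
          Real.Gamma (ν + (j + m : ℕ) + k + 1)))
      (Real.Gamma (ν + (ν + j)) * Real.Gamma ((m : ℝ) + 1) / Real.Gamma (ν + (ν + j) + (m + 1)) /
        (Real.Gamma (ν + 1) * Real.Gamma (ν + j))) := by
    have h := (mm_key ν (ν + j) m hν (by linarith)).div_const
      (Real.Gamma (ν + 1) * Real.Gamma (ν + j))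
    convert! h using 2 with k
    rw [mm_choose_Gamma ν hν k]
    have e1 : ((j + m : ℕ) : ℝ) + k + 1 - j = m + k + 1 := by push_cast; ring
    have e2 : ν + ((j + m : ℕ) : ℝ) + k + 1 = ν + j + (m + k + 1) := by push_cast; ring
    rw [e1, e2]
    field_simp
  refine ⟨hS.summable, ?_⟩
  rw [hS.tsum_eq]
  have e3 : ((j + m : ℕ) : ℝ) + 1 - j = m + 1 := by push_cast; ring
  have e4 : ((j + m : ℕ) : ℝ) - j = m := by push_cast; ring
  rw [e3, e4]
  have hI : ∫ v in (0:ℝ)..1, ∫ u in (0:ℝ)..v,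
          u ^ (ν + (i : ℝ) - 1) * v ^ ν * (v - u) ^ ((j : ℝ) - i - 1) *
            (1 - v) ^ (m : ℝ) =
      (Real.Gamma (ν + i) * Real.Gamma ((j : ℝ) - i) / Real.Gamma (ν + j)) *
      (Real.Gamma (ν + (ν + j)) * Real.Gamma ((m : ℝ) + 1) /
        Real.Gamma (ν + (ν + j) + (m + 1))) := by
    have hb := mm_beta (ν + (ν + j)) (m + 1) 1 (by linarith) (by positivity) one_pos
    rw [Real.one_rpow, one_mul] at hb
    rw [← hb, ← intervalIntegral.integral_const_mul]
    apply intervalIntegral.integral_congr_ae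
    filter_upwards with v hv
    rw [Set.uIoc_of_le zero_le_one] at hv
    have hb2 := mm_beta (ν + i) ((j : ℝ) - i) v (by linarith) hij' hv.1
    have e5 : ν + i + ((j : ℝ) - i) = ν + j := by ring
    rw [e5] at hb2
    have e6 : ν + (ν + (j : ℝ)) - 1 = ν + (ν + j - 1) := by ring
    rw [e6, Real.rpow_add hv.1, add_sub_cancel_right]
    calc _ = ∫ u in (0:ℝ)..v, (v ^ ν * (1 - v) ^ (m : ℝ)) *
          (u ^ (ν + (i : ℝ) - 1) * (v - u) ^ ((j : ℝ) - i - 1)) := by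
          congr 1; ext u; ring
      _ = _ := by
          rw [intervalIntegral.integral_const_mul, hb2]; ring
  rw [hI]
  field_simp
end
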